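/- Let m ≥ 2 and consider the NBCRW transition matrix P^B on the rose graph R_m^4: P^B(0, 3p+1) = P^B(0, 3p+2) = 1/(2m); P^B(3p+1, 0) = P^B(3p+2, 0) = m/(m + √(2m−1)); P^B(3p+1, 3p+3) = P^B(3p+2, 3p+3) = √(2m−1)/(m + √(2m−1)); P^B(3p+3, 3p+1) = P^B(3p+3, 3p+2) = 1/2 for every p ∈ {0,…,m−1}, and all other entries 0. Define π by π(0) = m/(2(m + √(2m−1))), π(i) = 1/(4m) for each internal node i, and π(j) = (m√(2m−1) − 2m + 1)/(2m(m−1)²) for each peripheral node j. Then π is a probability vector (all entries positive and summing to 1) and π P^B = π; that is, π is the stationary distribution of the NBCRW on R_m^4. -/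

import Mathlib

open Finset
/-- Transition matrix of the non-backtracking centrality based random walk (NBCRW) on the
rose graph `R_m^4`: from the hub (vertex `0`) probability `1/(2m)` to each internal node;
from each internal node probability `m/(m+√(2m-1))` to the hub and `√(2m-1)/(m+√(2m-1))`
to its peripheral neighbor; from each peripheral node probability `1/2` to each of its
two internal neighbors. -/
noncomputable def rosePB (m : ℕ) : Matrix (Fin (3 * m + 1)) (Fin (3 * m + 1)) ℝ :=
  fun i j =>
    if (i : ℕ) = 0 ∧ (j : ℕ) % 3 ≠ 0 then 1 / (2 * (m : ℝ))
    else if (i : ℕ) % 3 ≠ 0 ∧ (j : ℕ) = 0 then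
      (m : ℝ) / ((m : ℝ) + Real.sqrt (2 * (m : ℝ) - 1))
    else if ((i : ℕ) % 3 = 1 ∧ (j : ℕ) = (i : ℕ) + 2)
        ∨ ((i : ℕ) % 3 = 2 ∧ (j : ℕ) = (i : ℕ) + 1) then
      Real.sqrt (2 * (m : ℝ) - 1) / ((m : ℝ) + Real.sqrt (2 * (m : ℝ) - 1))
    else if (i : ℕ) % 3 = 0 ∧ (i : ℕ) ≠ 0
        ∧ ((j : ℕ) + 2 = (i : ℕ) ∨ (j : ℕ) + 1 = (i : ℕ)) then 1 / 2
    else 0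

/-- A sum over the vertices of the rose graph, split into the hub and the petals. -/
theorem sum_rose_vertices {M : Type*} [AddCommMonoid M] :
    ∀ (m : ℕ) (f : Fin (3 * m + 1) → M),
      ∑ i, f i = f 0 + ∑ p : Fin m, (f ⟨3 * p + 1, by omega⟩ + f ⟨3 * p + 2, by omega⟩
        + f ⟨3 * p + 3, by omega⟩)
  | 0, f => by simp
  | m + 1, f => by
    have key : ∑ i, f i = ∑ i : Fin (3 * m + 1), f ⟨i, by omega⟩
        + f ⟨3 * m + 1, by omega⟩ + f ⟨3 * m + 2, by omega⟩ + f ⟨3 * m + 3, by omega⟩ := by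
      rw [show ∑ i, f i = ∑ i : Fin (3 * m + 1 + 1 + 1 + 1), f ⟨i, by omega⟩ from rfl,
        Fin.sum_univ_castSucc, Fin.sum_univ_castSucc, Fin.sum_univ_castSucc]
      rfl
    rw [key, sum_rose_vertices m fun i => f ⟨i, by omega⟩, Fin.sum_univ_castSucc]
    simp only [Fin.val_castSucc, Fin.val_last, add_assoc]
    rfl

/-- Stationary distribution of the NBCRW on the rose graph `R_m^4`: the vector with
value `m/(2(m+√(2m-1)))` at the hub, `1/(4m)` at each internal node, and
`(m√(2m-1)-2m+1)/(2m(m-1)²)` at each peripheral node is a probability vector fixed by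
the NBCRW transition matrix. -/
theorem rose_nbcrw_stationary (m : ℕ) (hm : 2 ≤ m)
    (pvec : Fin (3 * m + 1) → ℝ)
    (hpvec : ∀ i, pvec i =
      if (i : ℕ) = 0 then (m : ℝ) / (2 * ((m : ℝ) + Real.sqrt (2 * (m : ℝ) - 1)))
      else if (i : ℕ) % 3 ≠ 0 then 1 / (4 * (m : ℝ))
      else ((m : ℝ) * Real.sqrt (2 * (m : ℝ) - 1) - 2 * (m : ℝ) + 1)
             / (2 * (m : ℝ) * ((m : ℝ) - 1) ^ 2)) :
    (∀ i, 0 < pvec i) ∧ (∑ i, pvec i) = 1 ∧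
      ∀ j, (∑ i, pvec i * rosePB m i j) = pvec j := by
  have hm' : (2 : ℝ) ≤ m := by exact_mod_cast hm
  have hs0 : 0 < Real.sqrt (2 * (m : ℝ) - 1) := Real.sqrt_pos.mpr (by linarith)
  have hs2 : Real.sqrt (2 * (m : ℝ) - 1) ^ 2 = 2 * m - 1 := Real.sq_sqrt (by linarith)
  unfold rosePB
  generalize Real.sqrt (2 * (m : ℝ) - 1) = s at *
  have hms : 0 < (m : ℝ) + s := by linarith
  have hperiph : ((m : ℝ) * s - 2 * m + 1) / (2 * m * ((m : ℝ) - 1) ^ 2)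
      = s / (2 * m * (m + s)) := by
    have h1 : (m : ℝ) - 1 ≠ 0 := by linarith
    field_simp
    linear_combination m * hs2
  rw [hperiph] at hpvec
  refine ⟨fun i => ?_, ?_, fun j => ?_⟩
  · rw [hpvec]
    split_ifs <;> positivity
  · have h1 (p : ℕ) : (3 * p + 1) % 3 = 1 := by omega
    have h2 (p : ℕ) : (3 * p + 2) % 3 = 2 := by omega
    rw [sum_rose_vertices]
    simp [hpvec, h1, h2]
    field_simp
    ring
  · have h1 (p : ℕ) : (3 * p + 1) % 3 = 1 := by omega
    have h2 (p : ℕ) : (3 * p + 2) % 3 = 2 := by omega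
    obtain ⟨j, hj⟩ := j
    rw [sum_rose_vertices]
    simp only [hpvec]
    obtain rfl | ⟨q, hq, rfl | rfl | rfl⟩ : j = 0 ∨ ∃ q < m,
        j = 3 * q + 1 ∨ j = 3 * q + 2 ∨ j = 3 * q + 3 := by
      by_cases h : j = 0
      · exact .inl h
      · exact .inr ⟨(j - 1) / 3, by omega, by omega⟩
    · simp [h1, h2]
      field_simp
      ring
    all_goals
      rw [Finset.sum_eq_single_of_mem (⟨q, hq⟩ : Fin m) (Finset.mem_univ _)]
      · simp [h1, h2]
        first | done | (field_simp; ring)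
      · intro p _ hp
        have hpq : (p : ℕ) ≠ q := fun h => hp (Fin.ext h)
        have sum_products_eq_zero {a b c d e f : ℝ} (hb : b = 0) (hd : d = 0) (hf : f = 0) :
            a * b + c * d + e * f = 0 := by simp [hb, hd, hf]
        refine sum_products_eq_zero ?_ ?_ ?_ <;>
          rw [if_neg (by omega), if_neg (by omega), if_neg (by omega), if_neg (by omega)]
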